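/- A priori estimates, uniform in the viscosity parameter (Theorem 4.3). Assume the Hamiltonian H = (H^j) satisfies (H0)–(H4) and at least one of the following: (i) for every j ∈ J and x ∈ (0,l_j), (r,p) ↦ H^j(x,r,p) is C¹ on ℝ×ℝ; (ii) r ↦ H^j(y,r,p) is strictly increasing for every y,p,j; (iii) there is K > 0 with |H^j(x,r,p) − H^j(x,s,q)| ≤ K(|r−s|+|p−q|) for all x,r,s,p,q,j. Let β = (β_{ij}) with β_{ij} > 0 for all i ∈ I_T, j ∈ Inc_i, let (g_i)_{i∈I_B} ⊂ ℝ, and assume there exist δ > 0 and ψ ∈ C²(Γ) such that H^j(x, ψ(x), ∂_j ψ(x)) ≤ −δ for all x ∈ (0,l_j) and j ∈ J, S^i_β ψ ≥ 0 for all i ∈ I_T, and ψ(v_i) = g_i for all i ∈ I_B. Assume that for each ε > 0 there exists a solution u_ε ∈ C²_{*,β}(Γ) of the viscous problem: −ε ∂²_j u_ε(x) + H^j(x, u_ε(x), ∂_j u_ε(x)) = 0 for all x ∈ (0,l_j), j ∈ J, and u_ε(v_i) = g_i for all i ∈ I_B. Then there exist ε̄ > 0 and a constant C > 0, independent of ε,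 such that for all 0 < ε < ε̄: sup_{j∈J} sup_{[0,l_j]} |u_ε^j| ≤ C and sup_{j∈J} sup_{[0,l_j]} |∂_j u_ε| ≤ C (the functions u_ε are uniformly bounded and equi-Lipschitz continuous on Γ). -/

import Mathlib

open Set

noncomputable section

/-- A finite connected topological network. -/
structure Network where
  I : Type
  J : Type
  finI : Fintype I
  finJ : Fintype J
  neI : Nonempty I
  neJ : Nonempty J
  l : J → ℝ
  l_pos : ∀ j, 0 < l j
  s : J → I
  t : J → I
  st_ne : ∀ j, s j ≠ t j
  conn : ∀ i i' : I,
    Relation.ReflTransGen (fun a b => ∃ j, (s j = a ∧ t j = b) ∨ (s j = b ∧ t j = a)) i i'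
  IB : Set I
  IB_ne : IB.Nonempty
  deg_one_bd : ∀ i : I, ({j : J | s j = i ∨ t j = i} : Set J).ncard = 1 → i ∈ IB

attribute [instance] Network.finI Network.finJ Network.neI Network.neJ

namespace Network

open scoped Classical

variable (N : Network)

/-- The set of edges incident to the vertex `i`. -/
def Inc (i : N.I) : Set N.J := {j | N.s j = i ∨ N.t j = i}

/-- The set of transition vertices. -/
def IT : Set N.I := N.IBᶜ

/-- The signed incidence `a_{ij}`. -/
def sgn (i : N.I) (j : N.J) : ℝ := if N.s j = i then 1 else -1

/-- The parameter `y_i^j` of the vertex `i` on the edge `j`. -/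
def param (i : N.I) (j : N.J) : ℝ := if N.s j = i then 0 else N.l j

/-- The edge `j` as a parameter interval. -/
def edge (j : N.J) : Set ℝ := Icc 0 (N.l j)

/-- A family `(u^j)` of functions on the edges defines a function on the network iff
the values at each vertex agree. -/
def Compat (u : N.J → ℝ → ℝ) : Prop :=
  ∀ i : N.I, ∀ j ∈ N.Inc i, ∀ k ∈ N.Inc i, u j (N.param i j) = u k (N.param i k)

/-- `u ∈ C(Γ)`. -/
def IsCont (u : N.J → ℝ → ℝ) : Prop :=
  N.Compat u ∧ ∀ j, ContinuousOn (u j) (N.edge j)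

/-- `u ∈ C²(Γ)`. -/
def IsC2 (u : N.J → ℝ → ℝ) : Prop :=
  N.Compat u ∧ ∀ j, ContDiffOn ℝ 2 (u j) (N.edge j)

/-- First derivative `∂_j u` along the edge `j`. -/
def pd (u : N.J → ℝ → ℝ) (j : N.J) (x : ℝ) : ℝ := derivWithin (u j) (N.edge j) x

/-- Second derivative `∂²_j u` along the edge `j`. -/
def pd2 (u : N.J → ℝ → ℝ) (j : N.J) (x : ℝ) : ℝ := derivWithin (N.pd u j) (N.edge j) x

/-- Sum over the edges incident to `i`. -/
def incSum (i : N.I) (f : N.J → ℝ) : ℝ := ∑ j : N.J, if j ∈ N.Inc i then f j else 0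

/-- The Kirchhoff sum `S^i_β u`. -/
def kir (β : N.I → N.J → ℝ) (u : N.J → ℝ → ℝ) (i : N.I) : ℝ :=
  N.incSum i (fun j => β i j * N.sgn i j * N.pd u j (N.param i j))

/-- `u ∈ C²_{*,β}(Γ)`. -/
def IsC2Star (β : N.I → N.J → ℝ) (u : N.J → ℝ → ℝ) : Prop :=
  N.IsC2 u ∧ ∀ i ∈ N.IT, N.kir β u i = 0

/-- (H0): continuity of each `H^j`. -/
def H0 (H : N.J → ℝ → ℝ → ℝ → ℝ) : Prop :=
  ∀ j, ContinuousOn (fun q : ℝ × ℝ × ℝ => H j q.1 q.2.1 q.2.2)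
    ((N.edge j) ×ˢ (univ : Set ℝ) ×ˢ (univ : Set ℝ))

/-- (H1): `r ↦ H^j(x,r,p)` is nondecreasing. -/
def H1 (H : N.J → ℝ → ℝ → ℝ → ℝ) : Prop :=
  ∀ j, ∀ x ∈ N.edge j, ∀ p : ℝ, Monotone fun r => H j x r p

/-- (H3): `p ↦ H^j(v_i,r,p)` is nondecreasing on `(0,∞)` at transition vertices. -/
def H3 (H : N.J → ℝ → ℝ → ℝ → ℝ) : Prop :=
  ∀ i ∈ N.IT, ∀ j ∈ N.Inc i, ∀ r : ℝ,
    MonotoneOn (fun p => H j (N.param i j) r p) (Ioi (0 : ℝ))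

/-- (H4): coercivity in `p`, uniform on bounded `r`-sets. -/
def H4 (H : N.J → ℝ → ℝ → ℝ → ℝ) : Prop :=
  ∀ j, ∀ R : ℝ, 0 < R → ∀ A : ℝ, ∃ M : ℝ, ∀ x ∈ N.edge j, ∀ r : ℝ, |r| ≤ R →
    ∀ p : ℝ, M < |p| → A < H j x r p

/-- (H5): continuity of `H` at the transition vertices. -/
def H5 (H : N.J → ℝ → ℝ → ℝ → ℝ) : Prop :=
  ∀ i ∈ N.IT, ∀ j ∈ N.Inc i, ∀ k ∈ N.Inc i, ∀ r p : ℝ,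
    H j (N.param i j) r p = H k (N.param i k) r p

/-- (H6): symmetry of `H` in `p` at the transition vertices. -/
def H6 (H : N.J → ℝ → ℝ → ℝ → ℝ) : Prop :=
  ∀ i ∈ N.IT, ∀ j ∈ N.Inc i, ∀ r p : ℝ,
    H j (N.param i j) r p = H j (N.param i j) r (-p)

end Network

section OneDimensional

variable {f f' : ℝ → ℝ} {a b x : ℝ}

theorem deriv_mul_sub_nonneg_of_le {d y : ℝ} (hf : HasDerivWithinAt f d (Icc a b) x)
    (hmin : ∀ z ∈ Icc a b, f x ≤ f z) (hx : x ∈ Icc a b) (hy : y ∈ Icc a b) :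
    0 ≤ d * (y - x) := by
  have h1 : IsLocalMinOn f (Icc a b) x := (isMinOn_iff.2 hmin).localize
  have h2 := h1.hasFDerivWithinAt_nonneg hf.hasFDerivWithinAt
    (sub_mem_posTangentConeAt_of_segment_subset ((convex_Icc a b).segment_subset hx hy))
  simpa [mul_comm] using h2

theorem exists_lt_of_deriv2_pos_of_lt
    (hf : ∀ y ∈ Icc a b, HasDerivWithinAt f (f' y) (Icc a b) y)
    (hx : a ≤ x) (hxb : x < b) (h1 : f' x = 0) {d : ℝ} (hd : 0 < d)
    (h2 : HasDerivWithinAt f' d (Icc a b) x) : ∃ y ∈ Icc a b, f x < f y := by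
  have h3 : HasDerivWithinAt f' d (Ioi x) x :=
    (h2.mono (Icc_subset_Icc hx le_rfl)).mono_of_mem_nhdsWithin (Icc_mem_nhdsGT hxb)
  have h4 := (hasDerivWithinAt_iff_tendsto_slope' self_notMem_Ioi).1 h3
  have h5 : ∀ᶠ y in nhdsWithin x (Ioi x), 0 < slope f' x y := h4.eventually (lt_mem_nhds hd)
  obtain ⟨c, hc, hsub⟩ := (mem_nhdsGT_iff_exists_Ioo_subset' hxb).1 h5
  obtain ⟨y, hy1, hy2⟩ := exists_between (lt_min hc hxb)
  have hyc := hy2.trans_le (min_le_left _ _)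
  have hyb := hy2.trans_le (min_le_right _ _)
  have hsubset : Icc x y ⊆ Icc a b := Icc_subset_Icc hx hyb.le
  refine ⟨y, ⟨hx.trans hy1.le, hyb.le⟩, ?_⟩
  obtain ⟨z, hz, hzd⟩ := exists_hasDerivAt_eq_slope f f' hy1
    (fun z hz => (hf z (hsubset hz)).continuousWithinAt.mono hsubset)
    (fun z hz => (hf z (hsubset (Ioo_subset_Icc_self hz))).hasDerivAt
      (Icc_mem_nhds (hx.trans_lt hz.1) (hz.2.trans hyb)))
  have h6 : 0 < slope f' x z := hsub ⟨hz.1, hz.2.trans hyc⟩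
  rw [slope_def_field, h1, sub_zero] at h6
  have h7 : 0 < f' z := by
    have := mul_pos h6 (sub_pos.2 hz.1)
    rwa [div_mul_cancel₀ _ (sub_pos.2 hz.1).ne'] at this
  rw [hzd] at h7
  have := mul_pos h7 (sub_pos.2 hy1)
  rw [div_mul_cancel₀ _ (sub_pos.2 hy1).ne'] at this
  linarith

theorem hasDerivWithinAt_comp_neg {d : ℝ} (hf : HasDerivWithinAt f d (Icc a b) (-x)) :
    HasDerivWithinAt (fun z => f (-z)) (-d) (Icc (-b) (-a)) x := by
  have h := hf.scomp x (hasDerivWithinAt_neg x (Icc (-b) (-a)))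
    (fun z hz => ⟨by linarith [hz.2], by linarith [hz.1]⟩)
  simpa [Function.comp_def] using h

theorem exists_lt_of_deriv2_pos (hab : a < b)
    (hf : ∀ y ∈ Icc a b, HasDerivWithinAt f (f' y) (Icc a b) y)
    (hx : x ∈ Icc a b) (h1 : f' x = 0) {d : ℝ} (hd : 0 < d)
    (h2 : HasDerivWithinAt f' d (Icc a b) x) : ∃ y ∈ Icc a b, f x < f y := by
  rcases hx.2.lt_or_eq with h | h
  · exact exists_lt_of_deriv2_pos_of_lt hf hx.1 h h1 hd h2
  · subst h
    have h3 : HasDerivWithinAt (fun z => -f' (-z)) d (Icc (-x) (-a)) (-x) := by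
      have := (hasDerivWithinAt_comp_neg (x := -x) (by simpa using h2)).neg
      rwa [neg_neg] at this
    obtain ⟨y, hy, hlt⟩ := exists_lt_of_deriv2_pos_of_lt (f := fun z => f (-z))
      (f' := fun z => -f' (-z)) (a := -x) (b := -a) (x := -x)
      (fun y hy => hasDerivWithinAt_comp_neg
        (hf (-y) ⟨by linarith [hy.2], by linarith [hy.1]⟩))
      le_rfl (by linarith) (by simp [h1]) hd h3
    exact ⟨-y, ⟨by linarith [hy.2], by linarith [hy.1]⟩, by simpa using hlt⟩

theorem le_right_of_deriv_pos {M : ℝ}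
    (hf : ∀ y ∈ Icc a b, HasDerivWithinAt f (f' y) (Icc a b) y)
    (hpos : ∀ y ∈ Icc a b, M < f y → 0 < f' y)
    (hx : x ∈ Icc a b) (hMx : M < f x) {y : ℝ} (hy : y ∈ Icc x b) : f x ≤ f y := by
  have hsub : Icc x b ⊆ Icc a b := Icc_subset_Icc hx.1 le_rfl
  refine image_le_of_deriv_right_lt_deriv_boundary' (f := fun _ => f x) (f' := fun _ => 0)
    (B := f) (B' := f') continuousOn_const (fun z _ => hasDerivWithinAt_const _ _ _) le_rfl
    (fun z hz => (hf z (hsub hz)).continuousWithinAt.mono hsub) (fun z hz => ?_)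
    (fun z hz h => ?_) hy
  · exact ((hf z (hsub (Ico_subset_Icc_self hz))).mono
      (Icc_subset_Icc (hx.1.trans hz.1) le_rfl)).mono_of_mem_nhdsWithin (Icc_mem_nhdsGE hz.2)
  · exact hpos z (hsub (Ico_subset_Icc_self hz)) (by rw [← h]; exact hMx)

theorem le_left_of_deriv_pos {M : ℝ}
    (hf : ∀ y ∈ Icc a b, HasDerivWithinAt f (f' y) (Icc a b) y)
    (hpos : ∀ y ∈ Icc a b, f y < -M → 0 < f' y)
    (hx : x ∈ Icc a b) (hMx : f x < -M) {y : ℝ} (hy : y ∈ Icc a x) : f y ≤ f x := by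
  have h := le_right_of_deriv_pos (f := fun z => -f (-z)) (f' := fun z => f' (-z))
    (a := -b) (b := -a) (x := -x) (y := -y) (M := M)
    (fun z hz => by
      have := (hasDerivWithinAt_comp_neg
        (hf (-z) ⟨by linarith [hz.2], by linarith [hz.1]⟩)).neg
      rwa [neg_neg] at this)
    (fun z hz hM => hpos (-z) ⟨by linarith [hz.2], by linarith [hz.1]⟩ (by linarith))
    ⟨by linarith [hx.2], by linarith [hx.1]⟩ (by simpa using (by linarith : M < -f x))
    ⟨by linarith [hy.2], by linarith [hy.1]⟩
  simpa using h

end OneDimensional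

namespace Network

variable {N : Network} {u ψ : N.J → ℝ → ℝ} {β : N.I → N.J → ℝ} {i : N.I} {j : N.J} {x : ℝ}

theorem left_mem_edge (j : N.J) : (0 : ℝ) ∈ N.edge j := ⟨le_rfl, (N.l_pos j).le⟩

theorem right_mem_edge (j : N.J) : N.l j ∈ N.edge j := ⟨(N.l_pos j).le, le_rfl⟩

theorem param_mem_edge (i : N.I) (j : N.J) : N.param i j ∈ N.edge j := by
  unfold param
  split_ifs
  exacts [left_mem_edge j, right_mem_edge j]

theorem uniqueDiffOn_edge (j : N.J) : UniqueDiffOn ℝ (N.edge j) :=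
  uniqueDiffOn_Icc (N.l_pos j)

theorem source_mem_Inc (j : N.J) : j ∈ N.Inc (N.s j) := Or.inl rfl

theorem target_mem_Inc (j : N.J) : j ∈ N.Inc (N.t j) := Or.inr rfl

theorem param_source (j : N.J) : N.param (N.s j) j = 0 := by simp [param]

theorem param_target (j : N.J) : N.param (N.t j) j = N.l j := by simp [param, N.st_ne j]

theorem sgn_source (j : N.J) : N.sgn (N.s j) j = 1 := by simp [sgn]

theorem sgn_target (j : N.J) : N.sgn (N.t j) j = -1 := by simp [sgn, N.st_ne j]

theorem IsC2.contDiffOn_pd (hu : N.IsC2 u) (j : N.J) : ContDiffOn ℝ 1 (N.pd u j) (N.edge j) :=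
  (hu.2 j).derivWithin (uniqueDiffOn_edge j) (by norm_num)

theorem IsC2.hasDerivWithinAt (hu : N.IsC2 u) (hx : x ∈ N.edge j) :
    HasDerivWithinAt (u j) (N.pd u j x) (N.edge j) x :=
  ((hu.2 j).differentiableOn (by norm_num) x hx).hasDerivWithinAt

theorem IsC2.hasDerivWithinAt_pd (hu : N.IsC2 u) (hx : x ∈ N.edge j) :
    HasDerivWithinAt (N.pd u j) (N.pd2 u j x) (N.edge j) x :=
  ((hu.contDiffOn_pd j).differentiableOn (by norm_num) x hx).hasDerivWithinAt

theorem IsC2.continuousOn_pd2 (hu : N.IsC2 u) (j : N.J) :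
    ContinuousOn (N.pd2 u j) (N.edge j) :=
  (hu.contDiffOn_pd j).continuousOn_derivWithin (uniqueDiffOn_edge j) le_rfl

theorem H0.continuousOn_comp {H : N.J → ℝ → ℝ → ℝ → ℝ} (hH : N.H0 H) (hu : N.IsC2 u) (j : N.J) :
    ContinuousOn (fun x => H j x (u j x) (N.pd u j x)) (N.edge j) :=
  (hH j).comp (continuousOn_id.prodMk
    ((hu.2 j).continuousOn.prodMk (hu.contDiffOn_pd j).continuousOn))
    (fun _ hx => ⟨hx, mem_univ _, mem_univ _⟩)

theorem le_on_edge {f g : ℝ → ℝ} (hf : ContinuousOn f (N.edge j)) (hg : ContinuousOn g (N.edge j))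
    (h : ∀ x ∈ Ioo 0 (N.l j), f x ≤ g x) (hx : x ∈ N.edge j) : f x ≤ g x := by
  have hcl : x ∈ closure (Ioo 0 (N.l j)) := by
    rw [closure_Ioo (N.l_pos j).ne]; exact hx
  exact ContinuousWithinAt.closure_le hcl ((hf x hx).mono Ioo_subset_Icc_self)
    ((hg x hx).mono Ioo_subset_Icc_self) h

theorem exists_abs_le {f : N.J → ℝ → ℝ} (hf : ∀ j, ContinuousOn (f j) (N.edge j)) :
    ∃ C > 0, ∀ j, ∀ x ∈ N.edge j, |f j x| ≤ C := by
  have h : ∀ j, ∃ C, ∀ x ∈ N.edge j, |f j x| ≤ C := fun j =>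
    isCompact_Icc.exists_bound_of_continuousOn (hf j)
  choose C hC using h
  refine ⟨1 + ∑ j, |C j|, by positivity, fun j x hx => ?_⟩
  have := Finset.single_le_sum (f := fun j => |C j|) (fun j _ => abs_nonneg _)
    (Finset.mem_univ j)
  linarith [hC j x hx, le_abs_self (C j)]

theorem exists_isMax {f : N.J → ℝ → ℝ} (hf : ∀ j, ContinuousOn (f j) (N.edge j)) :
    ∃ j, ∃ x ∈ N.edge j, ∀ k, ∀ y ∈ N.edge k, f k y ≤ f j x := by
  have h : ∀ j, ∃ x ∈ N.edge j, ∀ y ∈ N.edge j, f j y ≤ f j x := fun j =>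
    isCompact_Icc.exists_isMaxOn ⟨0, left_mem_edge j⟩ (hf j)
  choose x hx hmax using h
  obtain ⟨j, hj⟩ := Finite.exists_max fun j => f j (x j)
  exact ⟨j, x j, hx j, fun k y hy => (hmax k y hy).trans (hj k)⟩

theorem kir_eq_sum (β : N.I → N.J → ℝ) (u : N.J → ℝ → ℝ) (i : N.I) [DecidablePred (· ∈ N.Inc i)] :
    N.kir β u i =
      ∑ j with j ∈ N.Inc i, β i j * (N.sgn i j * N.pd u j (N.param i j)) := by
  rw [Finset.sum_filter]
  unfold kir incSum
  refine Finset.sum_congr rfl fun j _ => ?_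
  split_ifs <;> ring

theorem exists_mem_edge_sub_param (i : N.I) (j : N.J) :
    ∃ y ∈ N.edge j, y - N.param i j = N.sgn i j * N.l j := by
  unfold param sgn
  split_ifs
  · exact ⟨N.l j, right_mem_edge j, by ring⟩
  · exact ⟨0, left_mem_edge j, by ring⟩

theorem inward_deriv_le (hu : N.IsC2 u) (hψ : N.IsC2 ψ)
    (h : ∀ x ∈ N.edge j,
      u j (N.param i j) - ψ j (N.param i j) ≤ u j x - ψ j x) :
    N.sgn i j * N.pd ψ j (N.param i j) ≤ N.sgn i j * N.pd u j (N.param i j) := by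
  obtain ⟨y, hy, hyd⟩ := exists_mem_edge_sub_param i j
  have hp := param_mem_edge i j
  have h1 := deriv_mul_sub_nonneg_of_le ((hu.hasDerivWithinAt hp).sub (hψ.hasDerivWithinAt hp))
    h hp hy
  rw [hyd] at h1
  have hl := N.l_pos j
  have h2 : 0 ≤ (N.sgn i j * N.pd u j (N.param i j)
      - N.sgn i j * N.pd ψ j (N.param i j)) * N.l j := by linarith
  linarith [nonneg_of_mul_nonneg_left h2 hl]

/-- At a transition vertex where `ψ - u` is maximal, the Kirchhoff conditions force the first
derivatives to agree on every incident edge. -/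
theorem pd_eq_of_isMax_vertex (hu : N.IsC2 u) (hψ : N.IsC2 ψ)
    (hβ : ∀ j ∈ N.Inc i, 0 < β i j) (hku : N.kir β u i = 0) (hkψ : 0 ≤ N.kir β ψ i)
    (hmax : ∀ j ∈ N.Inc i, ∀ x ∈ N.edge j,
      u j (N.param i j) - ψ j (N.param i j) ≤ u j x - ψ j x) (hj : j ∈ N.Inc i) :
    N.pd ψ j (N.param i j) = N.pd u j (N.param i j) := by
  classical
  have hle : ∀ k ∈ N.Inc i, β i k * (N.sgn i k * N.pd ψ k (N.param i k)) ≤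
      β i k * (N.sgn i k * N.pd u k (N.param i k)) := fun k hk =>
    mul_le_mul_of_nonneg_left (inward_deriv_le hu hψ (hmax k hk)) (hβ k hk).le
  have hsum : N.kir β ψ i = N.kir β u i := by
    refine le_antisymm ?_ (hku ▸ hkψ)
    rw [kir_eq_sum, kir_eq_sum]
    exact Finset.sum_le_sum fun k hk => hle k (Finset.mem_filter.1 hk).2
  rw [kir_eq_sum, kir_eq_sum, Finset.sum_eq_sum_iff_of_le
    (fun k hk => hle k (Finset.mem_filter.1 hk).2)] at hsum
  have h1 := mul_left_cancel₀ (hβ j hj).ne' (hsum j (by simpa using hj))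
  refine mul_left_cancel₀ ?_ h1
  unfold sgn
  split_ifs <;> norm_num

/-- Comparison with a strict subsolution of the viscous problem. -/
theorem le_of_strict_subsolution {H : N.J → ℝ → ℝ → ℝ → ℝ} (hH1 : N.H1 H)
    (hβ : ∀ i ∈ N.IT, ∀ j ∈ N.Inc i, 0 < β i j) {ε : ℝ} (hε : 0 < ε)
    (hu : N.IsC2 u) (hψ : N.IsC2 ψ)
    (hku : ∀ i ∈ N.IT, N.kir β u i = 0) (hkψ : ∀ i ∈ N.IT, 0 ≤ N.kir β ψ i)
    (hbd : ∀ i ∈ N.IB, ∀ j ∈ N.Inc i, ψ j (N.param i j) = u j (N.param i j))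
    (hsol : ∀ j, ∀ x ∈ N.edge j, H j x (u j x) (N.pd u j x) = ε * N.pd2 u j x)
    (hsub : ∀ j, ∀ x ∈ N.edge j, H j x (ψ j x) (N.pd ψ j x) < ε * N.pd2 ψ j x) :
    ∀ j, ∀ x ∈ N.edge j, ψ j x ≤ u j x := by
  obtain ⟨j, x, hx, hmax⟩ := exists_isMax (f := fun j x => ψ j x - u j x)
    fun j => (hψ.2 j).continuousOn.sub (hu.2 j).continuousOn
  by_contra! hcon
  obtain ⟨k, y, hy, hky⟩ := hcon
  have hpos : u j x < ψ j x := by linarith [hmax k y hy]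
  have hvertex : ∀ i, j ∈ N.Inc i → x = N.param i j → N.pd ψ j x = N.pd u j x := by
    rintro i hij rfl
    by_cases hi : i ∈ N.IB
    · exact absurd (hbd i hi j hij) hpos.ne'
    · refine pd_eq_of_isMax_vertex hu hψ (hβ i hi) (hku i hi) (hkψ i hi) ?_ hij
      intro k hk z hz
      rw [hu.1 i k hk j hij, hψ.1 i k hk j hij]
      linarith [hmax k z hz]
  have hd : N.pd ψ j x = N.pd u j x := by
    rcases hx.1.eq_or_lt with h0 | h0
    · exact hvertex (N.s j) (source_mem_Inc j) (by rw [param_source, ← h0])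
    rcases hx.2.eq_or_lt with hl | hl
    · exact hvertex (N.t j) (target_mem_Inc j) (by rw [param_target, hl])
    have hder := (hu.hasDerivWithinAt hx).sub (hψ.hasDerivWithinAt hx)
    have hmin : ∀ z ∈ N.edge j, (u j - ψ j) x ≤ (u j - ψ j) z := fun z hz => by
      have := hmax j z hz
      simp only [Pi.sub_apply]
      linarith
    have h1 := deriv_mul_sub_nonneg_of_le hder hmin hx (left_mem_edge j)
    have h2 := deriv_mul_sub_nonneg_of_le hder hmin hx (right_mem_edge j)
    nlinarith
  have hdd : 0 < N.pd2 ψ j x - N.pd2 u j x := by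
    have h1 := hsub j x hx
    have h2 := hsol j x hx
    have h3 := hH1 j x hx (N.pd u j x) hpos.le
    simp only at h3
    rw [hd] at h1
    exact sub_pos.2 (lt_of_mul_lt_mul_left (by linarith) hε.le)
  obtain ⟨z, hz, hlt⟩ := exists_lt_of_deriv2_pos (N.l_pos j)
    (fun z hz => (hψ.hasDerivWithinAt hz).sub (hu.hasDerivWithinAt hz)) hx
    (by simp [hd]) hdd ((hψ.hasDerivWithinAt_pd hx).sub (hu.hasDerivWithinAt_pd hx))
  have := hmax j z hz
  simp only [Pi.sub_apply] at hlt
  linarith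

open Classical in
/-- The value at the vertex `i` of a function on the network. -/
def vertexValue (u : N.J → ℝ → ℝ) (i : N.I) : ℝ :=
  if h : ∃ j, j ∈ N.Inc i then u h.choose (N.param i h.choose) else 0

theorem Compat.vertexValue_eq (hu : N.Compat u) (hj : j ∈ N.Inc i) :
    vertexValue u i = u j (N.param i j) := by
  have h : ∃ j, j ∈ N.Inc i := ⟨j, hj⟩
  unfold vertexValue
  rw [dif_pos h]
  exact hu i _ h.choose_spec _ hj

theorem exists_vertex_ratio_bound (β : N.I → N.J → ℝ)
    (hβ : ∀ i ∈ N.IT, ∀ j ∈ N.Inc i, 0 < β i j) :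
    ∃ K ≥ (1 : ℝ), ∀ i ∈ N.IT, ∀ j ∈ N.Inc i, (∑ k, |β i k|) ≤ K * β i j := by
  refine ⟨1 + ∑ i, ∑ j, (∑ k, |β i k|) / |β i j|, ?_, fun i hi j hj => ?_⟩
  · have : 0 ≤ ∑ i, ∑ j, (∑ k, |β i k|) / |β i j| := by positivity
    linarith
  · have hb := hβ i hi j hj
    have h1 : (∑ k, |β i k|) / |β i j| ≤ ∑ i, ∑ j, (∑ k, |β i k|) / |β i j| :=
      (Finset.single_le_sum (f := fun j => (∑ k, |β i k|) / |β i j|)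
        (fun j _ => by positivity) (Finset.mem_univ j)).trans
      (Finset.single_le_sum (f := fun i => ∑ j, (∑ k, |β i k|) / |β i j|)
        (fun i _ => by positivity) (Finset.mem_univ i))
    rw [abs_of_pos hb, div_le_iff₀ hb] at h1
    nlinarith

/-- A steep slope arriving at a transition vertex leaves through some other edge with a
comparable slope. -/
theorem exists_outgoing {K c : ℝ} (hc : 0 < c) (hβ : ∀ j ∈ N.Inc i, 0 < β i j)
    (hK : ∀ j ∈ N.Inc i, (∑ k, |β i k|) ≤ K * β i j) (hku : N.kir β u i = 0)
    (hj : j ∈ N.Inc i) (hlt : N.sgn i j * N.pd u j (N.param i j) < -(K * c)) :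
    ∃ k ∈ N.Inc i, c < N.sgn i k * N.pd u k (N.param i k) := by
  classical
  by_contra! hcon
  rw [kir_eq_sum, ← Finset.add_sum_erase _ _ (a := j) (by simpa using hj)] at hku
  have h1 : ∑ k ∈ ({k | k ∈ N.Inc i} : Finset N.J).erase j,
      β i k * (N.sgn i k * N.pd u k (N.param i k)) ≤ (∑ k, |β i k|) * c := by
    rw [Finset.sum_mul]
    refine (Finset.sum_le_sum (g := fun k => |β i k| * c) fun k hk => ?_).trans
      (Finset.sum_le_sum_of_subset_of_nonneg (Finset.subset_univ _)
        fun _ _ _ => by positivity)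
    have hk' : k ∈ N.Inc i := by simpa using (Finset.mem_of_mem_erase hk)
    rw [abs_of_pos (hβ k hk')]
    exact mul_le_mul_of_nonneg_left (hcon k hk') (hβ k hk').le
  have h2 := mul_lt_mul_of_pos_left hlt (hβ j hj)
  have h3 := mul_le_mul_of_nonneg_right (hK j hj) hc.le
  linarith

/-- Along an edge whose slope at one endpoint is steep and increasing, the function grows and the
slope at the other endpoint is at least as steep. -/
theorem exists_other_end {M c : ℝ} (hu : N.IsC2 u) (hM : 0 ≤ M) (hMc : M ≤ c)
    (hconv : ∀ j, ∀ x ∈ N.edge j, M < |N.pd u j x| → 0 < N.pd2 u j x)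
    (hj : j ∈ N.Inc i) (hlt : c < N.sgn i j * N.pd u j (N.param i j)) :
    ∃ i', j ∈ N.Inc i' ∧ N.sgn i' j * N.pd u j (N.param i' j) < -c ∧
      u j (N.param i j) < u j (N.param i' j) := by
  have hcont : ContinuousOn (u j) (Icc 0 (N.l j)) := (hu.2 j).continuousOn
  have hderiv : ∀ x ∈ Ioo 0 (N.l j), HasDerivAt (u j) (N.pd u j x) x := fun x hx =>
    (hu.hasDerivWithinAt (Ioo_subset_Icc_self hx)).hasDerivAt (Icc_mem_nhds hx.1 hx.2)
  obtain ⟨z, hz, hzd⟩ := exists_hasDerivAt_eq_slope (u j) (N.pd u j) (N.l_pos j) hcont hderiv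
  rw [sub_zero, eq_div_iff (N.l_pos j).ne'] at hzd
  have hl := N.l_pos j
  rcases hj with rfl | rfl
  · rw [sgn_source, param_source, one_mul] at hlt
    have hinc : ∀ y ∈ N.edge j, N.pd u j 0 ≤ N.pd u j y := fun y hy =>
      le_right_of_deriv_pos (fun y hy => hu.hasDerivWithinAt_pd hy)
        (fun y hy h => hconv j y hy (h.trans_le (le_abs_self _))) (left_mem_edge j)
        (hMc.trans_lt hlt) hy
    refine ⟨N.t j, target_mem_Inc j, ?_, ?_⟩
    · rw [sgn_target, param_target]
      linarith [hinc _ (right_mem_edge j)]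
    · rw [param_source, param_target]
      have := hinc z (Ioo_subset_Icc_self hz)
      nlinarith
  · rw [sgn_target, param_target] at hlt
    have hinc : ∀ y ∈ N.edge j, N.pd u j y ≤ N.pd u j (N.l j) := fun y hy =>
      le_left_of_deriv_pos (M := M) (fun y hy => hu.hasDerivWithinAt_pd hy)
        (fun y hy h => hconv j y hy (by linarith [neg_le_abs (N.pd u j y)])) (right_mem_edge j)
        (by linarith) hy
    refine ⟨N.s j, source_mem_Inc j, ?_, ?_⟩
    · rw [sgn_source, param_source]
      linarith [hinc _ (left_mem_edge j)]
    · rw [param_source, param_target]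
      have := hinc z (Ioo_subset_Icc_self hz)
      nlinarith

/-- Steep slopes propagate upwards through the network until they reach the boundary. -/
theorem not_inward_deriv_lt {M K : ℝ} (hM : 0 < M) (hK1 : 1 ≤ K) (hu : N.IsC2 u)
    (hβ : ∀ i ∈ N.IT, ∀ j ∈ N.Inc i, 0 < β i j)
    (hK : ∀ i ∈ N.IT, ∀ j ∈ N.Inc i, (∑ k, |β i k|) ≤ K * β i j)
    (hku : ∀ i ∈ N.IT, N.kir β u i = 0)
    (hconv : ∀ j, ∀ x ∈ N.edge j, M < |N.pd u j x| → 0 < N.pd2 u j x)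
    (hbd : ∀ i ∈ N.IB, ∀ j ∈ N.Inc i, -M ≤ N.sgn i j * N.pd u j (N.param i j))
    (n : ℕ) : ∀ i, ∀ j ∈ N.Inc i,
      ({i' | vertexValue u i < vertexValue u i'} : Set N.I).ncard < n →
      -(M * K ^ n) ≤ N.sgn i j * N.pd u j (N.param i j) := by
  induction n with
  | zero => intro i j _ h; omega
  | succ n ih =>
    intro i j hj hn
    have hMn : ∀ n : ℕ, M ≤ M * K ^ n := fun n =>
      le_mul_of_one_le_right hM.le (one_le_pow₀ hK1)
    by_contra! hlt
    by_cases hi : i ∈ N.IB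
    · linarith [hbd i hi j hj, hMn (n + 1)]
    obtain ⟨k, hk, hck⟩ := exists_outgoing (K := K) (hM.trans_le (hMn n)) (hβ i hi) (hK i hi)
      (hku i hi) hj (by rw [pow_succ] at hlt; linarith)
    obtain ⟨i', hk', hlt', hval⟩ := exists_other_end hu hM.le (hMn n) hconv hk hck
    rw [← hu.1.vertexValue_eq hk, ← hu.1.vertexValue_eq hk'] at hval
    have hss : ({v | vertexValue u i' < vertexValue u v} : Set N.I) ⊂
        {v | vertexValue u i < vertexValue u v} :=
      ⟨fun v hv => hval.trans hv, fun h => lt_irrefl (vertexValue u i') (h hval)⟩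
    have := Set.ncard_lt_ncard hss (Set.toFinite _)
    linarith [ih i' k hk' (by omega)]

theorem abs_pd_le {M C : ℝ} (hu : N.IsC2 u) (hMC : M ≤ C)
    (hconv : ∀ j, ∀ x ∈ N.edge j, M < |N.pd u j x| → 0 < N.pd2 u j x)
    (hend : ∀ i, ∀ j ∈ N.Inc i, -C ≤ N.sgn i j * N.pd u j (N.param i j))
    (hx : x ∈ N.edge j) : |N.pd u j x| ≤ C := by
  have hs := hend _ j (source_mem_Inc j)
  have ht := hend _ j (target_mem_Inc j)
  rw [sgn_source, param_source] at hs
  rw [sgn_target, param_target] at ht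
  rw [abs_le]
  constructor
  · by_contra! h
    have := le_left_of_deriv_pos (M := M) (fun y hy => hu.hasDerivWithinAt_pd hy)
      (fun y hy h => hconv j y hy (by linarith [neg_le_abs (N.pd u j y)])) hx
      (by linarith) (left_mem_Icc.2 hx.1)
    linarith
  · by_contra! h
    have := le_right_of_deriv_pos (M := M) (fun y hy => hu.hasDerivWithinAt_pd hy)
      (fun y hy h => hconv j y hy (h.trans_le (le_abs_self _))) hx
      (by linarith) (right_mem_Icc.2 hx.2)
    linarith

theorem abs_sub_le_of_abs_pd_le {C y : ℝ} (hu : N.IsC2 u) (hC : 0 ≤ C)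
    (h : ∀ x ∈ N.edge j, |N.pd u j x| ≤ C) (hx : x ∈ N.edge j) (hy : y ∈ N.edge j) :
    |u j y - u j x| ≤ C * N.l j := by
  have h1 := (convex_Icc 0 (N.l j)).norm_image_sub_le_of_norm_hasDerivWithin_le
    (fun z hz => hu.hasDerivWithinAt hz) h hx hy
  refine h1.trans (mul_le_mul_of_nonneg_left ?_ hC)
  rw [Real.norm_eq_abs, abs_le]
  constructor <;> linarith [hx.1, hx.2, hy.1, hy.2]

/-- A family with uniformly bounded derivatives and prescribed boundary values is uniformly
bounded. -/
theorem exists_abs_le_of_abs_pd_le (S : Set (N.J → ℝ → ℝ)) {C : ℝ} (hC : 0 ≤ C) (g : N.I → ℝ)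
    (hS : ∀ u ∈ S, N.IsC2 u) (hpd : ∀ u ∈ S, ∀ j, ∀ x ∈ N.edge j, |N.pd u j x| ≤ C)
    (hbd : ∀ u ∈ S, ∀ i ∈ N.IB, ∀ j ∈ N.Inc i, u j (N.param i j) = g i) :
    ∃ B, ∀ u ∈ S, ∀ j, ∀ x ∈ N.edge j, |u j x| ≤ B := by
  obtain ⟨i₀, hi₀⟩ := N.IB_ne
  have hvertex : ∀ i, ∃ B, ∀ u ∈ S, ∀ j ∈ N.Inc i, |u j (N.param i j)| ≤ B := by
    intro i
    induction N.conn i₀ i with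
    | refl => exact ⟨|g i₀|, fun u hu j hj => by rw [hbd u hu i₀ hi₀ j hj]⟩
    | @tail a b _ hab ih =>
      obtain ⟨B, hB⟩ := ih
      obtain ⟨j, hj⟩ := hab
      have hja : j ∈ N.Inc a := by
        rcases hj with h | h
        exacts [Or.inl h.1, Or.inr h.2]
      have hjb : j ∈ N.Inc b := by
        rcases hj with h | h
        exacts [Or.inr h.2, Or.inl h.1]
      refine ⟨C * N.l j + B, fun u hu k hk => ?_⟩
      rw [(hS u hu).1 b k hk j hjb]
      have h1 := abs_sub_le_of_abs_pd_le (hS u hu) hC (hpd u hu j) (param_mem_edge a j)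
        (param_mem_edge b j)
      have h2 := abs_sub_abs_le_abs_sub (u j (N.param b j)) (u j (N.param a j))
      linarith [hB u hu j hja]
  choose B hB using hvertex
  obtain ⟨k, hk⟩ := Finite.exists_max fun j => C * N.l j + B (N.s j)
  refine ⟨C * N.l k + B (N.s k), fun u hu j x hx => ?_⟩
  have h1 := abs_sub_le_of_abs_pd_le (hS u hu) hC (hpd u hu j) (param_mem_edge (N.s j) j) hx
  have h2 := abs_sub_abs_le_abs_sub (u j x) (u j (N.param (N.s j) j))
  linarith [hB _ u hu j (source_mem_Inc j), hk j]

theorem H4.exists_pos {H : N.J → ℝ → ℝ → ℝ → ℝ} (hH4 : N.H4 H) {R : ℝ} (hR : 0 < R) :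
    ∃ M, ∀ j, ∀ x ∈ N.edge j, ∀ p, M < |p| → 0 < H j x (-R) p := by
  choose M hM using fun j => hH4 j R hR 0
  obtain ⟨k, hk⟩ := Finite.exists_max M
  exact ⟨M k, fun j x hx p hp =>
    hM j x hx (-R) (by rw [abs_neg, abs_of_pos hR]) p ((hk j).trans_lt hp)⟩

theorem abs_sgn (i : N.I) (j : N.J) : |N.sgn i j| = 1 := by
  unfold sgn
  split_ifs <;> simp

end Network

open Network in
/-- **Theorem 4.3** (a priori estimates, uniform in the viscosity parameter). -/
theorem apriori_estimates
    (N : Network) (H : N.J → ℝ → ℝ → ℝ → ℝ)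
    (hH0 : N.H0 H) (hH1 : N.H1 H) (hH3 : N.H3 H) (hH4 : N.H4 H)
    (halt :
      (∀ j, ∀ x ∈ Set.Ioo (0 : ℝ) (N.l j),
          ContDiff ℝ 1 (fun q : ℝ × ℝ => H j x q.1 q.2)) ∨
      (∀ j, ∀ y ∈ N.edge j, ∀ p : ℝ, StrictMono fun r => H j y r p) ∨
      (∃ K > 0, ∀ j, ∀ x ∈ N.edge j, ∀ r s p q : ℝ,
          |H j x r p - H j x s q| ≤ K * (|r - s| + |p - q|)))
    (β : N.I → N.J → ℝ)
    (hβ : ∀ i ∈ N.IT, ∀ j ∈ N.Inc i, 0 < β i j)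
    (g : N.I → ℝ)
    (δ : ℝ) (hδ : 0 < δ) (ψ : N.J → ℝ → ℝ) (hψ : N.IsC2 ψ)
    (hψ1 : ∀ j, ∀ x ∈ Set.Ioo (0 : ℝ) (N.l j), H j x (ψ j x) (N.pd ψ j x) ≤ -δ)
    (hψ2 : ∀ i ∈ N.IT, 0 ≤ N.kir β ψ i)
    (hψ3 : ∀ i ∈ N.IB, ∀ j ∈ N.Inc i, ψ j (N.param i j) = g i)
    (u : ℝ → N.J → ℝ → ℝ)
    (husol : ∀ ε : ℝ, 0 < ε → N.IsC2Star β (u ε) ∧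
      (∀ j, ∀ x ∈ Set.Ioo (0 : ℝ) (N.l j),
        -ε * N.pd2 (u ε) j x + H j x (u ε j x) (N.pd (u ε) j x) = 0) ∧
      (∀ i ∈ N.IB, ∀ j ∈ N.Inc i, u ε j (N.param i j) = g i)) :
    ∃ εb > 0, ∃ C > 0, ∀ ε : ℝ, 0 < ε → ε < εb →
      ∀ j, ∀ x ∈ N.edge j, |u ε j x| ≤ C ∧ |N.pd (u ε) j x| ≤ C := by
  obtain ⟨R, hR, hψR⟩ := exists_abs_le fun j => (hψ.2 j).continuousOn
  obtain ⟨L, hL, hψL⟩ := exists_abs_le fun j => (hψ.contDiffOn_pd j).continuousOn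
  obtain ⟨A, hA, hψA⟩ := exists_abs_le hψ.continuousOn_pd2
  obtain ⟨M₀, hM₀⟩ := hH4.exists_pos hR
  obtain ⟨K, hK1, hK⟩ := exists_vertex_ratio_bound β hβ
  set M := max M₀ L
  have hM : 0 < M := hL.trans_le (le_max_right _ _)
  set n := Nat.card N.I + 1
  have hMC : M ≤ M * K ^ n := le_mul_of_one_le_right hM.le (one_le_pow₀ hK1)
  have hpd : ∀ ε : ℝ, 0 < ε → ε < δ / A → ∀ j, ∀ x ∈ N.edge j,
      |N.pd (u ε) j x| ≤ M * K ^ n := by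
    intro ε hε hεA j x hx
    obtain ⟨⟨hu, hku⟩, hode, hbd⟩ := husol ε hε
    have hsol : ∀ j, ∀ x ∈ N.edge j,
        H j x (u ε j x) (N.pd (u ε) j x) = ε * N.pd2 (u ε) j x := by
      intro j x hx
      have hc1 := hH0.continuousOn_comp hu j
      have hc2 : ContinuousOn (fun x => ε * N.pd2 (u ε) j x) (N.edge j) :=
        continuousOn_const.mul (hu.continuousOn_pd2 j)
      exact le_antisymm (le_on_edge hc1 hc2 (fun y hy => by linarith [hode j y hy]) hx)
        (le_on_edge hc2 hc1 (fun y hy => by linarith [hode j y hy]) hx)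
    have hsub : ∀ j, ∀ x ∈ N.edge j,
        H j x (ψ j x) (N.pd ψ j x) < ε * N.pd2 ψ j x := by
      intro j x hx
      have h1 := le_on_edge (hH0.continuousOn_comp hψ j) continuousOn_const (hψ1 j) hx
      have h2 := mul_le_mul_of_nonneg_left (neg_le_of_abs_le (hψA j x hx)) hε.le
      have h3 := (lt_div_iff₀ hA).1 hεA
      linarith
    have hle : ∀ j, ∀ x ∈ N.edge j, ψ j x ≤ u ε j x :=
      le_of_strict_subsolution hH1 hβ hε hu hψ hku hψ2
        (fun i hi j hj => by rw [hψ3 i hi j hj, hbd i hi j hj]) hsol hsub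
    have hconv : ∀ j, ∀ x ∈ N.edge j, M < |N.pd (u ε) j x| → 0 < N.pd2 (u ε) j x := by
      intro j x hx hlt
      have h1 := hM₀ j x hx _ ((le_max_left _ _).trans_lt hlt)
      have h2 : -R ≤ u ε j x := (neg_le_of_abs_le (hψR j x hx)).trans (hle j x hx)
      have h3 := hH1 j x hx (N.pd (u ε) j x) h2
      have h4 : 0 < ε * N.pd2 (u ε) j x := by
        rw [← hsol j x hx]
        exact h1.trans_le h3
      exact pos_of_mul_pos_right h4 hε.le
    have hbdM : ∀ i ∈ N.IB, ∀ j ∈ N.Inc i,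
        -M ≤ N.sgn i j * N.pd (u ε) j (N.param i j) := by
      intro i hi j hj
      have h1 := inward_deriv_le (i := i) (j := j) hu hψ fun x hx => by
        rw [hbd i hi j hj, hψ3 i hi j hj]
        linarith [hle j x hx]
      have h2 : |N.sgn i j * N.pd ψ j (N.param i j)| ≤ L := by
        rw [abs_mul, abs_sgn, one_mul]
        exact hψL j _ (param_mem_edge i j)
      linarith [neg_le_of_abs_le h2, le_max_right M₀ L]
    refine abs_pd_le hu hMC hconv (fun i j hj => ?_) hx
    refine not_inward_deriv_lt hM hK1 hu hβ hK hku hconv hbdM n i j hj ?_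
    exact Nat.lt_succ_of_le (Set.ncard_le_card _)
  obtain ⟨B, hB⟩ := exists_abs_le_of_abs_pd_le {v | ∃ ε, 0 < ε ∧ ε < δ / A ∧ u ε = v}
    (hM.le.trans hMC) g
    (by rintro _ ⟨ε, hε, -, rfl⟩; exact (husol ε hε).1.1)
    (by rintro _ ⟨ε, hε, hεA, rfl⟩; exact hpd ε hε hεA)
    (by rintro _ ⟨ε, hε, -, rfl⟩; exact (husol ε hε).2.2)
  refine ⟨δ / A, div_pos hδ hA, max B (M * K ^ n), lt_max_of_lt_right (hM.trans_le hMC),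
    fun ε hε hεA j x hx => ⟨?_, ?_⟩⟩
  · exact (hB _ ⟨ε, hε, hεA, rfl⟩ j x hx).trans (le_max_left _ _)
  · exact (hpd ε hε hεA j x hx).trans (le_max_right _ _)
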